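/- Itô formula (chain rule) for nonlinear Young integrals: Let W : ℝ × ℝ^d → ℝ^d satisfy condition (W′) with exponents τ, λ ∈ (0,1], let φ : ℝ → ℝ^d be γ-Hölder continuous with τ + λγ > 1, and set x_t = ∫_a^t W(ds, φ_s). Let F : ℝ × ℝ^d → ℝ^d be such that F(t,·) is continuously differentiable for each t, F satisfies condition (W′) with exponents τ_F = τ and λ_F, the gradient ∇F is λ_F-Hölder continuous in x uniformly in t on compact sets, and ∇F is τ-Hölder in t locally uniformly in x; assume τλ_F + τ > 1. Then for all a ≤ b, F(b, x_b) − F(a, x_a) = ∫_a^b F(dt, x_t) + ∫_a^b (∇F)(t, x_t) W(dt, φ_t), where ∫_a^b F(dt, x_t) is the limit of the Riemann sums Σ [F(t_{i+1}, x_{t_i}) − F(t_i, x_{t_i})] and ∫_a^b (∇F)(t, x_t) W(dt, φ_t) is the limit of the Riemann sums Σ (∇F)(t_i, x_{t_i})[W(t_{i+1}, φ_{t_i}) − W(t_i, φ_{t_i})], both over partitions of [a,b] as the mesh tends to 0. -/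

import Mathlib

open scoped BigOperators

noncomputable section

/-- `t : Fin (m+1) → ℝ` is a partition `a = t₀ < t₁ < ⋯ < t_m = b` of `[a,b]`. -/
def IsPartition (a b : ℝ) (m : ℕ) (t : Fin (m + 1) → ℝ) : Prop :=
  StrictMono t ∧ t 0 = a ∧ t (Fin.last m) = b

/-- The mesh `|π| = max_i (t_{i+1} - t_i)` of a partition. -/
def partMesh (m : ℕ) (t : Fin (m + 1) → ℝ) : ℝ :=
  ⨆ i : Fin m, (t i.succ - t i.castSucc)

/-- The Riemann sums `Σ_{i=0}^{m-1} μ(t_i, t_{i+1})` over partitions of `[a,b]`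
converge to `I` as the mesh tends to `0`. -/
def RiemannLimit {B : Type*} [NormedAddCommGroup B] (a b : ℝ) (μ : ℝ → ℝ → B) (I : B) : Prop :=
  ∀ ε : ℝ, 0 < ε → ∃ δ : ℝ, 0 < δ ∧ ∀ (m : ℕ) (t : Fin (m + 1) → ℝ),
    IsPartition a b m t → partMesh m t < δ →
    ‖(∑ i : Fin m, μ (t i.castSucc) (t i.succ)) - I‖ < ε

/-- `I` is the value of the nonlinear Young integral `∫_a^b W(ds, φ_s)`. -/
def HasYoungIntegral {d : ℕ} (W : ℝ → EuclideanSpace ℝ (Fin d) → EuclideanSpace ℝ (Fin d))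
    (φ : ℝ → EuclideanSpace ℝ (Fin d)) (a b : ℝ) (I : EuclideanSpace ℝ (Fin d)) : Prop :=
  RiemannLimit a b (fun s t => W t (φ s) - W s (φ s)) I

/-- The set of quotients entering the Hölder seminorm `‖φ‖_{γ;a,b}`. -/
def holderSet {F : Type*} [NormedAddCommGroup F] (φ : ℝ → F) (γ a b : ℝ) : Set ℝ :=
  {r | ∃ s t : ℝ, a ≤ s ∧ s < t ∧ t ≤ b ∧ r = ‖φ t - φ s‖ / (t - s) ^ γ}

/-- `φ` is `γ`-Hölder continuous on `[a,b]`. -/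
def HolderOn {F : Type*} [NormedAddCommGroup F] (φ : ℝ → F) (γ a b : ℝ) : Prop :=
  BddAbove (holderSet φ γ a b)

/-- Condition (W′): joint local Hölder bounds on every `[a,b] × K` with `K ⊆ ℝ^d` compact. -/
def ConditionWloc {d : ℕ} (W : ℝ → EuclideanSpace ℝ (Fin d) → EuclideanSpace ℝ (Fin d))
    (τ lam : ℝ) : Prop :=
  ∀ a b : ℝ, a < b → ∀ K : Set (EuclideanSpace ℝ (Fin d)), IsCompact K →
    (∃ C : ℝ, ∀ (s t : ℝ) (x y : EuclideanSpace ℝ (Fin d)),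
      a ≤ s → s ≤ t → t ≤ b → x ∈ K → y ∈ K →
      ‖W s x - W t x - W s y + W t y‖ ≤ C * (t - s) ^ τ * ‖x - y‖ ^ lam) ∧
    (∃ C : ℝ, ∀ (s t : ℝ) (x : EuclideanSpace ℝ (Fin d)),
      a ≤ s → s ≤ t → t ≤ b → x ∈ K → ‖W s x - W t x‖ ≤ C * (t - s) ^ τ) ∧
    (∃ C : ℝ, ∀ (t : ℝ) (x y : EuclideanSpace ℝ (Fin d)),
      a ≤ t → t ≤ b → x ∈ K → y ∈ K → ‖W t x - W t y‖ ≤ C * ‖x - y‖ ^ lam)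

section Helpers

variable {E : Type*} [NormedAddCommGroup E]

theorem yi_fin_telescope (m : ℕ) (t : Fin (m + 1) → E) :
    ∑ i : Fin m, (t i.succ - t i.castSucc) = t (Fin.last m) - t 0 := by
  induction m with
  | zero => simp
  | succ n ih =>
    rw [Fin.sum_univ_castSucc]
    have := ih (fun i => t i.castSucc)
    simp only [Fin.succ_castSucc] at this ⊢
    rw [this]
    simp

theorem yi_riemann_of_approx {a b θ K : ℝ} (hab : a ≤ b) (hθ : 1 < θ) (hK : 0 ≤ K)
    (f : ℝ → E) (μ : ℝ → ℝ → E)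
    (h : ∀ s t, a ≤ s → s ≤ t → t ≤ b → ‖f t - f s - μ s t‖ ≤ K * (t - s) ^ θ) :
    RiemannLimit a b μ (f b - f a) := by
  intro ε hε
  have hM : 0 ≤ K * (b - a) := mul_nonneg hK (by linarith)
  have hq : 0 < ε / (K * (b - a) + 1) := by positivity
  refine ⟨(ε / (K * (b - a) + 1)) ^ (1 / (θ - 1)), Real.rpow_pos_of_pos hq _, ?_⟩
  intro m t ⟨hmono, h0, hl⟩ hmesh
  set δ := (ε / (K * (b - a) + 1)) ^ (1 / (θ - 1)) with hδ
  have hδθ : δ ^ (θ - 1) = ε / (K * (b - a) + 1) := by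
    rw [hδ, ← Real.rpow_mul hq.le, one_div_mul_cancel (by linarith), Real.rpow_one]
  have hδ0 : 0 < δ := Real.rpow_pos_of_pos hq _
  have hta : ∀ i, a ≤ t i := fun i => h0 ▸ hmono.monotone (Fin.zero_le i)
  have htb : ∀ i, t i ≤ b := fun i => hl ▸ hmono.monotone (Fin.le_last i)
  have hf : f b - f a = ∑ i : Fin m, (f (t i.succ) - f (t i.castSucc)) := by
    rw [yi_fin_telescope m (fun i => f (t i)), h0, hl]
  have hlen : ∑ i : Fin m, (t i.succ - t i.castSucc) = b - a := by
    rw [yi_fin_telescope m t, h0, hl]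
  have hterm : ∀ i : Fin m, ‖μ (t i.castSucc) (t i.succ) - (f (t i.succ) - f (t i.castSucc))‖
      ≤ K * δ ^ (θ - 1) * (t i.succ - t i.castSucc) := by
    intro i
    have hlt : t i.castSucc < t i.succ := hmono Fin.castSucc_lt_succ
    have hd : t i.succ - t i.castSucc ≤ δ := by
      refine le_trans ?_ hmesh.le
      exact le_ciSup (f := fun i : Fin m => t i.succ - t i.castSucc) (Set.finite_range _).bddAbove i
    have hpos : 0 < t i.succ - t i.castSucc := by linarith
    rw [norm_sub_rev]
    refine (h _ _ (hta _) hlt.le (htb _)).trans ?_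
    have : (t i.succ - t i.castSucc) ^ θ
        = (t i.succ - t i.castSucc) ^ (θ - 1) * (t i.succ - t i.castSucc) := by
      rw [← Real.rpow_add_one hpos.ne']; ring_nf
    rw [this, mul_assoc]
    gcongr
  rw [hf, ← Finset.sum_sub_distrib]
  calc _ ≤ ∑ i : Fin m, K * δ ^ (θ - 1) * (t i.succ - t i.castSucc) :=
        norm_sum_le_of_le _ (fun i _ => hterm i)
    _ = K * (b - a) * (ε / (K * (b - a) + 1)) := by
        rw [← Finset.mul_sum, hlen, hδθ]; ring
    _ < ε := by
        rw [mul_div_assoc', div_lt_iff₀ (by linarith)]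
        nlinarith

theorem yi_riemann_unique {a b : ℝ} (hab : a ≤ b) (μ : ℝ → ℝ → E) {I J : E}
    (hI : RiemannLimit a b μ I) (hJ : RiemannLimit a b μ J) : I = J := by
  by_contra hne
  have hε : 0 < ‖I - J‖ / 2 := by
    have := norm_pos_iff.2 (sub_ne_zero.2 hne); positivity
  obtain ⟨δ₁, h1, H1⟩ := hI _ hε
  obtain ⟨δ₂, h2, H2⟩ := hJ _ hε
  obtain ⟨m, t, ht, hm⟩ : ∃ (m : ℕ) (t : Fin (m + 1) → ℝ), IsPartition a b m t ∧
      partMesh m t < min δ₁ δ₂ := by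
    have hδ : 0 < min δ₁ δ₂ := lt_min h1 h2
    rcases hab.eq_or_lt with rfl | hlt
    · refine ⟨0, fun _ => a, ⟨?_, rfl, rfl⟩, ?_⟩
      · intro i j hij; omega
      · simpa [partMesh] using hδ
    · obtain ⟨n, hn⟩ := exists_nat_gt ((b - a) / min δ₁ δ₂)
      have hn0 : (0 : ℝ) < n := lt_of_le_of_lt (div_nonneg (by linarith) hδ.le) hn
      have hba : 0 < b - a := by linarith
      refine ⟨n, fun i => a + (i : ℕ) * ((b - a) / n), ⟨?_, by simp, ?_⟩, ?_⟩
      · intro i j hij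
        have : ((i : ℕ) : ℝ) < (j : ℕ) := by exact_mod_cast hij
        have : 0 < (b - a) / n := by positivity
        simp only
        nlinarith
      · simp only [Fin.val_last]; field_simp; ring
      · have hstep : (b - a) / n < min δ₁ δ₂ := by
          rw [div_lt_iff₀ hδ] at hn
          rw [div_lt_iff₀ hn0]; linarith
        have : Nonempty (Fin n) := ⟨⟨0, by exact_mod_cast hn0⟩⟩
        refine lt_of_le_of_lt (ciSup_le fun i => ?_) hstep
        simp only [Fin.val_succ, Fin.val_castSucc]; push_cast
        linarith
  have e1 := H1 m t ht (hm.trans_le (min_le_left _ _))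
  have e2 := H2 m t ht (hm.trans_le (min_le_right _ _))
  set S := ∑ i : Fin m, μ (t i.castSucc) (t i.succ)
  have : ‖I - J‖ ≤ ‖S - J‖ + ‖S - I‖ := by
    have : I - J = (S - J) - (S - I) := by abel
    rw [this]; exact norm_sub_le _ _
  linarith

/-- Discrete sewing estimate. -/
theorem yi_discrete {a b θ C K : ℝ} (hθ : 1 < θ) (hC : 0 ≤ C)
    (hK : K = 2 * C / (1 - 2 * (1 / 2) ^ θ))
    (μ : ℝ → ℝ → E)
    (h : ∀ s u t, a ≤ s → s ≤ u → u ≤ t → t ≤ b →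
      ‖μ s t - μ s u - μ u t‖ ≤ C * (t - s) ^ θ)
    (t : ℕ → ℝ) (ht : Monotone t) (hta : ∀ i, a ≤ t i) (htb : ∀ i, t i ≤ b) :
    ∀ k m, ‖∑ i ∈ Finset.Ico m (m + k), μ (t i) (t (i + 1)) - μ (t m) (t (m + k))‖
      ≤ K * (t (m + k) - t m) ^ θ := by
  have hhalf : (2 : ℝ) * (1 / 2) ^ θ < 1 := by
    have : ((1 : ℝ) / 2) ^ θ < (1 / 2) ^ (1 : ℝ) :=
      Real.rpow_lt_rpow_of_exponent_gt (by norm_num) (by norm_num) hθ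
    rw [Real.rpow_one] at this; linarith
  have hK0 : 0 ≤ K := by rw [hK]; apply div_nonneg <;> linarith
  have hKe : 2 * K * (1 / 2) ^ θ + 2 * C = K := by
    have : K * (1 - 2 * (1 / 2) ^ θ) = 2 * C := by
      rw [hK, div_mul_cancel₀]; linarith
    linarith
  intro k
  induction k using Nat.strong_induction_on with
  | _ k ih =>
  intro m
  rcases Nat.eq_zero_or_pos k with rfl | hk
  · have := h (t m) (t m) (t m) (hta m) le_rfl le_rfl (htb m)
    simp only [sub_self, zero_sub, norm_neg, add_zero, Finset.Ico_self, Finset.sum_empty] at this ⊢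
    rw [Real.zero_rpow (by linarith)] at this ⊢
    linarith
  set s := t m with hs
  set T := t (m + k) with hT
  have hsT : s ≤ T := ht (by omega)
  -- find the cell containing the midpoint
  obtain ⟨j, hjk, hj1, hj2⟩ : ∃ j, j < k ∧ t (m + j) ≤ (s + T) / 2 ∧ (s + T) / 2 ≤ t (m + j + 1) := by
    have hex : ∃ j, (s + T) / 2 ≤ t (m + j + 1) := ⟨k - 1, by
      have : m + (k - 1) + 1 = m + k := by omega
      rw [this, ← hT]; linarith⟩
    classical
    refine ⟨Nat.find hex, ?_, ?_, Nat.find_spec hex⟩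
    · have : Nat.find hex ≤ k - 1 := Nat.find_min' hex (by
        have : m + (k - 1) + 1 = m + k := by omega
        rw [this, ← hT]; linarith)
      omega
    · rcases Nat.eq_zero_or_pos (Nat.find hex) with h0 | h0
      · rw [h0, add_zero, ← hs]; linarith
      · have := Nat.find_min hex (m := Nat.find hex - 1) (by omega)
        have e : m + (Nat.find hex - 1) + 1 = m + Nat.find hex := by omega
        rw [e] at this
        exact (not_le.1 this).le
  have e2 : m + j + 1 + (k - 1 - j) = m + k := by omega
  have i1 := ih j hjk m
  have i2 := ih (k - 1 - j) (by omega) (m + j + 1)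
  rw [e2] at i2
  have hsum : ∑ i ∈ Finset.Ico m (m + k), μ (t i) (t (i + 1))
      = ∑ i ∈ Finset.Ico m (m + j), μ (t i) (t (i + 1)) + (μ (t (m + j)) (t (m + j + 1))
        + ∑ i ∈ Finset.Ico (m + j + 1) (m + k), μ (t i) (t (i + 1))) := by
    rw [← Finset.sum_Ico_consecutive _ (show m ≤ m + j by omega) (show m + j ≤ m + k by omega),
      Finset.sum_eq_sum_Ico_succ_bot (show m + j < m + k by omega)]
  have l1 : s ≤ t (m + j) := ht (by omega)
  have l2 : t (m + j) ≤ t (m + j + 1) := ht (by omega)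
  have l3 : t (m + j + 1) ≤ T := ht (by omega)
  have d1 := h s (t (m + j)) T (hta _) l1 (l2.trans l3) (htb _)
  have d2 := h (t (m + j)) (t (m + j + 1)) T (hta _) l2 l3 (htb _)
  have hpow : ∀ r, 0 ≤ r → r ≤ (T - s) / 2 → r ^ θ ≤ (1 / 2) ^ θ * (T - s) ^ θ := by
    intro r hr hr2
    rw [← Real.mul_rpow (by norm_num) (by linarith)]
    exact Real.rpow_le_rpow hr (by linarith) (by linarith)
  have p1 := hpow (t (m + j) - s) (by linarith) (by linarith)
  have p2 := hpow (T - t (m + j + 1)) (by linarith) (by linarith)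
  have p3 : (T - t (m + j)) ^ θ ≤ (T - s) ^ θ :=
    Real.rpow_le_rpow (by linarith) (by linarith) (by linarith)
  rw [← hs] at i1
  rw [← hT] at i2
  rw [hsum]
  set S1 := ∑ i ∈ Finset.Ico m (m + j), μ (t i) (t (i + 1))
  set S2 := ∑ i ∈ Finset.Ico (m + j + 1) (m + k), μ (t i) (t (i + 1))
  set u := t (m + j)
  set v := t (m + j + 1)
  have key : S1 + (μ u v + S2) - μ s T
      = ((S1 - μ s u) + (S2 - μ v T)) - ((μ s T - μ s u - μ u T) + (μ u T - μ u v - μ v T)) := by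
    abel
  rw [key]
  have n1 := norm_sub_le ((S1 - μ s u) + (S2 - μ v T))
    ((μ s T - μ s u - μ u T) + (μ u T - μ u v - μ v T))
  have n2 := norm_add_le (S1 - μ s u) (S2 - μ v T)
  have n3 := norm_add_le (μ s T - μ s u - μ u T) (μ u T - μ u v - μ v T)
  have q1 := mul_le_mul_of_nonneg_left p1 hK0
  have q2 := mul_le_mul_of_nonneg_left p2 hK0
  have q3 := mul_le_mul_of_nonneg_left p3 hC
  have fin : K * (T - s) ^ θ = (2 * K * (1 / 2) ^ θ + 2 * C) * (T - s) ^ θ := by rw [hKe]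
  rw [fin]
  linarith

/-- Continuous sewing lemma. -/
theorem yi_sewing [ProperSpace E] {a b θ C : ℝ} (hab : a ≤ b) (hθ : 1 < θ) (hC : 0 ≤ C)
    (μ : ℝ → ℝ → E)
    (h : ∀ s u t, a ≤ s → s ≤ u → u ≤ t → t ≤ b →
      ‖μ s t - μ s u - μ u t‖ ≤ C * (t - s) ^ θ) :
    ∃ (K : ℝ) (f : ℝ → E), 0 ≤ K ∧
      ∀ s t, a ≤ s → s ≤ t → t ≤ b → ‖f t - f s - μ s t‖ ≤ K * (t - s) ^ θ := by
  have hhalf : (2 : ℝ) * (1 / 2) ^ θ < 1 := by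
    have : ((1 : ℝ) / 2) ^ θ < (1 / 2) ^ (1 : ℝ) :=
      Real.rpow_lt_rpow_of_exponent_gt (by norm_num) (by norm_num) hθ
    rw [Real.rpow_one] at this; linarith
  obtain ⟨K, hK⟩ : ∃ K, K = 2 * C / (1 - 2 * (1 / 2) ^ θ) := ⟨_, rfl⟩
  have hK0 : 0 ≤ K := by rw [hK]; apply div_nonneg <;> linarith
  -- grid and clamped grid
  let g : ℕ → ℕ → ℝ := fun n i => a + i * ((b - a) / (n + 1))
  have hstep : ∀ n : ℕ, 0 ≤ (b - a) / ((n : ℝ) + 1) := fun n =>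
    div_nonneg (by linarith) (by positivity)
  have hgmono : ∀ n, Monotone (g n) := by
    intro n i j hij
    have : (i : ℝ) ≤ j := by exact_mod_cast hij
    have := mul_le_mul_of_nonneg_right this (hstep n)
    simp only [g]; linarith
  have hg0 : ∀ n, g n 0 = a := by intro n; simp [g]
  have hgl : ∀ n, g n (n + 1) = b := by
    intro n
    have : (n : ℝ) + 1 ≠ 0 := by positivity
    simp only [g]; push_cast; field_simp; ring
  let c : ℕ → ℝ → ℝ → ℕ → ℝ := fun n s t i => max s (min t (g n i))
  let S : ℕ → ℝ → ℝ → E := fun n s t =>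
    ∑ i ∈ Finset.Ico 0 (0 + (n + 1)), μ (c n s t i) (c n s t (i + 1))
  have hcmono : ∀ n s t, Monotone (c n s t) := fun n s t i j hij =>
    max_le_max le_rfl (min_le_min le_rfl (hgmono n hij))
  have hSb : ∀ n s t, a ≤ s → s ≤ t → t ≤ b → ‖S n s t - μ s t‖ ≤ K * (t - s) ^ θ := by
    intro n s t has hst htb
    have := yi_discrete hθ hC hK μ h (c n s t) (hcmono n s t)
      (fun i => has.trans (le_max_left _ _))
      (fun i => max_le (hst.trans htb) ((min_le_left _ _).trans htb)) (n + 1) 0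
    have c0 : c n s t 0 = s := by
      simp only [c, hg0]; exact max_eq_left ((min_le_right _ _).trans has)
    have c1 : c n s t (0 + (n + 1)) = t := by
      simp only [c, zero_add, hgl]; rw [min_eq_left htb, max_eq_right hst]
    rw [c0, c1] at this
    exact this
  have hzero : ∀ s, a ≤ s → s ≤ b → μ s s = 0 := by
    intro s h1 h2
    have := h s s s h1 le_rfl le_rfl h2
    rw [sub_self, sub_self, zero_sub, norm_neg, Real.zero_rpow (by linarith), mul_zero] at this
    exact norm_le_zero_iff.1 this
  -- approximate additivity
  have hSadd : ∀ n s t, a ≤ s → s ≤ t → t ≤ b →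
      ‖S n a t - S n a s - S n s t‖ ≤ ((n : ℝ) + 1) * (C * ((b - a) / (n + 1)) ^ θ) := by
    intro n s t has hst htb
    simp only [S]
    rw [← Finset.sum_sub_distrib, ← Finset.sum_sub_distrib]
    have hterm : ∀ i ∈ Finset.Ico 0 (0 + (n + 1)),
        ‖μ (c n a t i) (c n a t (i + 1)) - μ (c n a s i) (c n a s (i + 1))
          - μ (c n s t i) (c n s t (i + 1))‖ ≤ C * ((b - a) / (n + 1)) ^ θ := by
      intro i _
      have hR : 0 ≤ C * ((b - a) / (n + 1)) ^ θ := mul_nonneg hC (Real.rpow_nonneg (hstep n) _)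
      have hpa : a ≤ g n i := by rw [← hg0 n]; exact hgmono n (Nat.zero_le _)
      have hpq : g n i ≤ g n (i + 1) := hgmono n (Nat.le_succ _)
      have hlen : g n (i + 1) - g n i = (b - a) / (n + 1) := by
        simp only [g]; push_cast; ring
      have hat : a ≤ t := has.trans hst
      simp only [c]
      rw [← hlen] at hR ⊢
      generalize g n i = p at *
      generalize g n (i + 1) = q at *
      have z := hzero s has (hst.trans htb)
      rw [max_eq_right (le_min hat hpa), max_eq_right (le_min hat (hpa.trans hpq)),
        max_eq_right (le_min has hpa), max_eq_right (le_min has (hpa.trans hpq))]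
      rcases le_total q s with hqs | hqs
      · rw [min_eq_right (hpq.trans (hqs.trans hst)), min_eq_right (hqs.trans hst),
          min_eq_right (hpq.trans hqs), min_eq_right hqs, max_eq_left (hpq.trans hqs),
          max_eq_left hqs, z]
        simpa using hR
      rcases le_total s p with hsp | hsp
      · rw [min_eq_left hsp, min_eq_left hqs, max_eq_right (le_min hst hsp),
          max_eq_right (le_min hst hqs), z]
        simpa using hR
      · rw [min_eq_right (hsp.trans hst), min_eq_right hsp, min_eq_left hqs, max_eq_left hsp,
          max_eq_right (le_min hst hqs)]
        refine (h p s (min t q) hpa hsp (le_min hst hqs) ((min_le_left _ _).trans htb)).trans ?_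
        have hm : min t q ≤ q := min_le_right _ _
        have hm2 : s ≤ min t q := le_min hst hqs
        gcongr
        linarith
    refine (norm_sum_le_of_le _ hterm).trans ?_
    simp
  have herr : Filter.Tendsto (fun n : ℕ => ((n : ℝ) + 1) * (C * ((b - a) / (n + 1)) ^ θ))
      Filter.atTop (nhds 0) := by
    have e : ∀ n : ℕ, ((n : ℝ) + 1) * (C * ((b - a) / (n + 1)) ^ θ)
        = C * (b - a) ^ θ * ((n : ℝ) + 1) ^ (-(θ - 1)) := by
      intro n
      have hn : (0 : ℝ) < (n : ℝ) + 1 := by positivity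
      rw [Real.div_rpow (by linarith) hn.le, neg_sub, Real.rpow_sub hn, Real.rpow_one]
      field_simp
    simp_rw [e]
    have t1 := (tendsto_rpow_neg_atTop (y := θ - 1) (by linarith)).comp
      (Filter.tendsto_atTop_add_const_right Filter.atTop (1 : ℝ) tendsto_natCast_atTop_atTop)
    simpa using t1.const_mul (C * (b - a) ^ θ)
  -- ultrafilter limit
  let U : Ultrafilter ℕ := Ultrafilter.of Filter.atTop
  have hU : (U : Filter ℕ) ≤ Filter.atTop := Ultrafilter.of_le _
  have hlim : ∀ s t, a ≤ s → s ≤ t → t ≤ b →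
      ∃ L ∈ Metric.closedBall (μ s t) (K * (t - s) ^ θ),
        Filter.Tendsto (fun n => S n s t) U (nhds L) := by
    intro s t h1 h2 h3
    have hc := isCompact_closedBall (μ s t) (K * (t - s) ^ θ)
    have := hc.ultrafilter_le_nhds' (U.map (fun n => S n s t)) (by
      refine Filter.Eventually.of_forall (f := (U : Filter ℕ)) (fun n => ?_)
      simpa [dist_eq_norm] using hSb n s t h1 h2 h3)
    exact this
  choose! L hLball hL using hlim
  refine ⟨K, fun t => L a t, hK0, fun s t h1 h2 h3 => ?_⟩
  have e : L a t - L a s = L s t := by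
    have t1 := ((hL a t le_rfl (h1.trans h2) h3).sub (hL a s le_rfl h1 (h2.trans h3))).sub
      (hL s t h1 h2 h3)
    have t2 : Filter.Tendsto (fun n => S n a t - S n a s - S n s t) U (nhds 0) :=
      squeeze_zero_norm (fun n => hSadd n s t h1 h2 h3) (herr.mono_left hU)
    exact sub_eq_zero.1 (tendsto_nhds_unique t1 t2)
  rw [e]
  simpa [dist_eq_norm] using hLball s t h1 h2 h3

theorem yi_rpow_le {r L p θ : ℝ} (hr : 0 ≤ r) (hrL : r ≤ L) (hθ : 0 < θ) (hp : θ ≤ p) :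
    r ^ p ≤ L ^ (p - θ) * r ^ θ := by
  have : r ^ p = r ^ (p - θ) * r ^ θ := by
    rw [← Real.rpow_add' hr (by linarith)]; ring_nf
  rw [this]
  gcongr

/-- A Hölder path and a field with joint Hölder bounds give a germ that can be sewn. -/
theorem yi_young {d : ℕ} (G : ℝ → EuclideanSpace ℝ (Fin d) → EuclideanSpace ℝ (Fin d))
    (ψ : ℝ → EuclideanSpace ℝ (Fin d)) {τ lam γ a b H : ℝ} (hab : a < b)
    (hτ : 0 < τ) (hlam : 0 < lam) (hγ : 0 < γ) (hG : ConditionWloc G τ lam) (hH : 0 ≤ H)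
    (hψ : ∀ s t, a ≤ s → s ≤ t → t ≤ b → ‖ψ t - ψ s‖ ≤ H * (t - s) ^ γ)
    (hsum : 1 < τ + lam * γ) :
    ∃ (K : ℝ) (f : ℝ → EuclideanSpace ℝ (Fin d)), 0 ≤ K ∧
      ∀ s t, a ≤ s → s ≤ t → t ≤ b →
        ‖f t - f s - (G t (ψ s) - G s (ψ s))‖ ≤ K * (t - s) ^ (τ + lam * γ) := by
  obtain ⟨⟨C, hC⟩, -, -⟩ := hG a b hab (Metric.closedBall (ψ a) (H * (b - a) ^ γ))
    (isCompact_closedBall _ _)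
  have hmem : ∀ s, a ≤ s → s ≤ b → ψ s ∈ Metric.closedBall (ψ a) (H * (b - a) ^ γ) := by
    intro s h1 h2
    rw [mem_closedBall_iff_norm]
    refine (hψ a s le_rfl h1 h2).trans ?_
    have : (s - a) ^ γ ≤ (b - a) ^ γ := Real.rpow_le_rpow (by linarith) (by linarith) hγ.le
    gcongr
  refine yi_sewing hab.le hsum (C := |C| * H ^ lam) (by positivity)
    (fun s t => G t (ψ s) - G s (ψ s)) ?_
  intro s u t h1 h2 h3 h4
  have e := hC u t (ψ u) (ψ s) (h1.trans h2) h3 h4 (hmem u (h1.trans h2) (h3.trans h4))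
    (hmem s h1 (h2.trans (h3.trans h4)))
  have e2 : G t (ψ s) - G s (ψ s) - (G u (ψ s) - G s (ψ s)) - (G t (ψ u) - G u (ψ u))
      = G u (ψ u) - G t (ψ u) - G u (ψ s) + G t (ψ s) := by abel
  rw [e2]
  refine e.trans ?_
  have a1 : (t - u) ^ τ ≤ (t - s) ^ τ := Real.rpow_le_rpow (by linarith) (by linarith) hτ.le
  have a2 : ‖ψ u - ψ s‖ ^ lam ≤ H ^ lam * (t - s) ^ (lam * γ) := by
    have b1 : ‖ψ u - ψ s‖ ≤ H * (t - s) ^ γ := by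
      refine (hψ s u h1 h2 (h3.trans h4)).trans ?_
      have : (u - s) ^ γ ≤ (t - s) ^ γ := Real.rpow_le_rpow (by linarith) (by linarith) hγ.le
      gcongr
    have hts : 0 ≤ t - s := by linarith
    calc ‖ψ u - ψ s‖ ^ lam ≤ (H * (t - s) ^ γ) ^ lam :=
          Real.rpow_le_rpow (norm_nonneg _) b1 hlam.le
      _ = H ^ lam * (t - s) ^ (lam * γ) := by
          rw [Real.mul_rpow hH (Real.rpow_nonneg hts _), ← Real.rpow_mul hts, mul_comm γ]
  have hts : 0 ≤ t - s := by linarith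
  have htu : 0 ≤ t - u := by linarith
  calc C * (t - u) ^ τ * ‖ψ u - ψ s‖ ^ lam
      ≤ |C| * (t - s) ^ τ * (H ^ lam * (t - s) ^ (lam * γ)) := by
        have := le_abs_self C
        gcongr
    _ = |C| * H ^ lam * (t - s) ^ (τ + lam * γ) := by
        rw [Real.rpow_add' hts (by linarith)]; ring

end Helpers

/-- **Itô formula (chain rule) for nonlinear Young integrals** (Theorem 3.4, formula (3.5)):
with `x_t = ∫_a^t W(ds, φ_s)`,
`F(b, x_b) − F(a, x_a) = ∫_a^b F(dt, x_t) + ∫_a^b (∇F)(t, x_t) W(dt, φ_t)`. -/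
theorem young_ito_formula
    (d : ℕ) (W F : ℝ → EuclideanSpace ℝ (Fin d) → EuclideanSpace ℝ (Fin d))
    (φ x : ℝ → EuclideanSpace ℝ (Fin d))
    (τ lam γ lamF : ℝ)
    (hτ : τ ∈ Set.Ioc (0 : ℝ) 1) (hlam : lam ∈ Set.Ioc (0 : ℝ) 1)
    (hγ : γ ∈ Set.Ioc (0 : ℝ) 1) (hlamF : lamF ∈ Set.Ioc (0 : ℝ) 1)
    (hW : ConditionWloc W τ lam)
    (hφ : ∀ a b : ℝ, a < b → HolderOn φ γ a b)
    (hsum : 1 < τ + lam * γ)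
    (a : ℝ)
    (hx : ∀ t : ℝ, a ≤ t → HasYoungIntegral W φ a t (x t))
    -- `F(t,·)` is continuously differentiable for each `t`
    (hFC1 : ∀ t : ℝ, ContDiff ℝ 1 (F t))
    -- `F` satisfies condition (W′) with exponents `τ_F = τ`, `λ_F`
    (hF : ConditionWloc F τ lamF)
    -- `∇F` is `λ_F`-Hölder in the space variable, uniformly in `t` on compact sets
    (hgradx : ∀ c b : ℝ, c < b → ∀ K : Set (EuclideanSpace ℝ (Fin d)), IsCompact K →
      ∃ C : ℝ, ∀ t ∈ Set.Icc c b, ∀ z w : EuclideanSpace ℝ (Fin d), z ∈ K → w ∈ K →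
        ‖fderiv ℝ (F t) z - fderiv ℝ (F t) w‖ ≤ C * ‖z - w‖ ^ lamF)
    -- `∇F` is `τ`-Hölder in `t`, locally uniformly in the space variable
    (hgradt : ∀ c b : ℝ, c < b → ∀ K : Set (EuclideanSpace ℝ (Fin d)), IsCompact K →
      ∃ C : ℝ, ∀ s t : ℝ, c ≤ s → s ≤ t → t ≤ b → ∀ z ∈ K,
        ‖fderiv ℝ (F t) z - fderiv ℝ (F s) z‖ ≤ C * (t - s) ^ τ)
    (hsumF : 1 < τ * lamF + τ) :
    ∀ b : ℝ, a ≤ b →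
      ∃ I₁ I₂ : EuclideanSpace ℝ (Fin d),
        RiemannLimit a b (fun s t => F t (x s) - F s (x s)) I₁ ∧
        RiemannLimit a b
          (fun s t => (fderiv ℝ (F s) (x s)) (W t (φ s) - W s (φ s))) I₂ ∧
        F b (x b) - F a (x a) = I₁ + I₂ := by
  intro b hab
  rcases hab.eq_or_lt with rfl | hlt
  · have h1 := yi_riemann_of_approx (E := EuclideanSpace ℝ (Fin d)) (K := 0) (θ := 2) (le_refl a)
      (by norm_num) le_rfl (fun _ => 0) (fun s t => F t (x s) - F s (x s)) (by
        intro s t h1 h2 h3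
        obtain rfl : s = t := le_antisymm h2 (h3.trans h1)
        simp)
    have h2 := yi_riemann_of_approx (E := EuclideanSpace ℝ (Fin d)) (K := 0) (θ := 2) (le_refl a)
      (by norm_num) le_rfl (fun _ => 0)
      (fun s t => (fderiv ℝ (F s) (x s)) (W t (φ s) - W s (φ s))) (by
        intro s t h1 h2 h3
        obtain rfl : s = t := le_antisymm h2 (h3.trans h1)
        simp)
    exact ⟨_, _, h1, h2, by simp⟩
  obtain ⟨hτ0, hτ1⟩ := hτ
  obtain ⟨hlam0, hlam1⟩ := hlam
  obtain ⟨hγ0, hγ1⟩ := hγ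
  obtain ⟨hF0, hF1⟩ := hlamF
  have hba : 0 < b - a := by linarith
  -- Hölder bound for `φ`
  obtain ⟨H, hH0, hH⟩ : ∃ H : ℝ, 0 ≤ H ∧ ∀ s t, a ≤ s → s ≤ t → t ≤ b →
      ‖φ t - φ s‖ ≤ H * (t - s) ^ γ := by
    obtain ⟨M, hM⟩ := hφ a b hlt
    refine ⟨|M|, abs_nonneg _, fun s t h1 h2 h3 => ?_⟩
    rcases h2.eq_or_lt with rfl | h2
    · simp [Real.zero_rpow hγ0.ne']
    · have := hM ⟨s, t, h1, h2, h3, rfl⟩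
      rw [div_le_iff₀ (Real.rpow_pos_of_pos (by linarith) _)] at this
      refine this.trans (mul_le_mul_of_nonneg_right (le_abs_self M) ?_)
      exact Real.rpow_nonneg (by linarith) _
  obtain ⟨K1, f1, hK1, hf1⟩ := yi_young W φ hlt hτ0 hlam0 hγ0 hW hH0 hH hsum
  have hxf : ∀ t, a ≤ t → t ≤ b → x t = f1 t - f1 a := fun t h1 h2 =>
    yi_riemann_unique h1 _ (hx t h1)
      (yi_riemann_of_approx h1 hsum hK1 f1 _ (fun s u e1 e2 e3 => hf1 s u e1 e2 (e3.trans h2)))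
  have hxs : ∀ s t, a ≤ s → s ≤ t → t ≤ b →
      ‖x t - x s - (W t (φ s) - W s (φ s))‖ ≤ K1 * (t - s) ^ (τ + lam * γ) := by
    intro s t h1 h2 h3
    rw [hxf t (h1.trans h2) h3, hxf s h1 (h2.trans h3), sub_sub_sub_cancel_right]
    exact hf1 s t h1 h2 h3
  -- `x` is `τ`-Hölder
  obtain ⟨X, hX0, hX⟩ : ∃ X : ℝ, 0 ≤ X ∧ ∀ s t, a ≤ s → s ≤ t → t ≤ b →
      ‖x t - x s‖ ≤ X * (t - s) ^ τ := by
    obtain ⟨-, ⟨C, hC⟩, -⟩ := hW a b hlt (Metric.closedBall (φ a) (H * (b - a) ^ γ))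
      (isCompact_closedBall _ _)
    refine ⟨K1 * (b - a) ^ (τ + lam * γ - τ) + |C|, by positivity, fun s t h1 h2 h3 => ?_⟩
    have hmem : φ s ∈ Metric.closedBall (φ a) (H * (b - a) ^ γ) := by
      rw [mem_closedBall_iff_norm]
      refine (hH a s le_rfl h1 (h2.trans h3)).trans ?_
      have : (s - a) ^ γ ≤ (b - a) ^ γ := Real.rpow_le_rpow (by linarith) (by linarith) hγ0.le
      gcongr
    have e1 := hC s t (φ s) h1 h2 h3 hmem
    have e2 := hxs s t h1 h2 h3
    have e3 := yi_rpow_le (r := t - s) (L := b - a) (p := τ + lam * γ) (θ := τ) (by linarith)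
      (by linarith) hτ0 (by nlinarith)
    have e4 : ‖x t - x s‖ ≤ ‖x t - x s - (W t (φ s) - W s (φ s))‖ + ‖W s (φ s) - W t (φ s)‖ := by
      rw [norm_sub_rev (W s (φ s))]
      simpa using norm_add_le (x t - x s - (W t (φ s) - W s (φ s))) (W t (φ s) - W s (φ s))
    have e5 := mul_le_mul_of_nonneg_left e3 hK1
    have e6 : C * (t - s) ^ τ ≤ |C| * (t - s) ^ τ :=
      mul_le_mul_of_nonneg_right (le_abs_self C) (Real.rpow_nonneg (by linarith) _)
    linarith
  obtain ⟨K2, f2, hK2, hf2⟩ := yi_young F x hlt hτ0 hF0 hτ0 hF hX0 hX (by linarith)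
  have hI1 := yi_riemann_of_approx hab (by linarith) hK2 f2 _ hf2
  -- gradient bounds
  set R := X * (b - a) ^ τ with hR
  have hR0 : 0 ≤ R := by positivity
  have hmem : ∀ s, a ≤ s → s ≤ b → x s ∈ Metric.closedBall (x a) R := by
    intro s h1 h2
    rw [mem_closedBall_iff_norm]
    refine (hX a s le_rfl h1 h2).trans ?_
    have : (s - a) ^ τ ≤ (b - a) ^ τ := Real.rpow_le_rpow (by linarith) (by linarith) hτ0.le
    rw [hR]
    gcongr
  obtain ⟨Cx, hCx⟩ := hgradx a b hlt _ (isCompact_closedBall (x a) R)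
  obtain ⟨Ct, hCt⟩ := hgradt a b hlt _ (isCompact_closedBall (x a) R)
  obtain ⟨M, hM0, hM⟩ : ∃ M : ℝ, 0 ≤ M ∧ ∀ s, a ≤ s → s ≤ b → ‖fderiv ℝ (F s) (x s)‖ ≤ M := by
    refine ⟨|Cx| * R ^ lamF + |Ct| * (b - a) ^ τ + ‖fderiv ℝ (F a) (x a)‖, by positivity,
      fun s h1 h2 => ?_⟩
    have e1 := hCx s ⟨h1, h2⟩ (x s) (x a) (hmem s h1 h2) (Metric.mem_closedBall_self hR0)
    have e2 := hCt a s le_rfl h1 h2 (x a) (Metric.mem_closedBall_self hR0)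
    have e3 : ‖x s - x a‖ ≤ R := mem_closedBall_iff_norm.1 (hmem s h1 h2)
    have e4 : Cx * ‖x s - x a‖ ^ lamF ≤ |Cx| * R ^ lamF := by
      have := le_abs_self Cx
      gcongr
    have e5 : Ct * (s - a) ^ τ ≤ |Ct| * (b - a) ^ τ := by
      have := le_abs_self Ct
      have h3 : 0 ≤ s - a := by linarith
      gcongr
    have e6 : fderiv ℝ (F s) (x s) = (fderiv ℝ (F s) (x s) - fderiv ℝ (F s) (x a))
        + (fderiv ℝ (F s) (x a) - fderiv ℝ (F a) (x a)) + fderiv ℝ (F a) (x a) := by abel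
    rw [e6]
    refine norm_add₃_le.trans ?_
    linarith
  obtain ⟨θ, hθ⟩ : ∃ θ, θ = min (τ + lam * γ) (τ + lamF * τ) := ⟨_, rfl⟩
  have hθ1 : 1 < θ := by rw [hθ]; exact lt_min hsum (by linarith)
  have hθa : θ ≤ τ + lam * γ := hθ ▸ min_le_left _ _
  have hθb : θ ≤ τ + lamF * τ := hθ ▸ min_le_right _ _
  have hθc : θ ≤ τ + τ := by nlinarith
  have hI2 := yi_riemann_of_approx (θ := θ)
    (K := K2 * (b - a) ^ (τ + lamF * τ - θ)
      + |Cx| * X ^ lamF * X * (b - a) ^ (τ + lamF * τ - θ)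
      + |Ct| * X * (b - a) ^ (τ + τ - θ) + M * K1 * (b - a) ^ (τ + lam * γ - θ))
    hab hθ1 (by positivity) (fun t => F t (x t) - f2 t)
    (fun s t => (fderiv ℝ (F s) (x s)) (W t (φ s) - W s (φ s))) (by
      intro s t h1 h2 h3
      have hts : 0 ≤ t - s := by linarith
      have htsb : t - s ≤ b - a := by linarith
      have r1 := yi_rpow_le hts htsb (by linarith) hθa
      have r2 := yi_rpow_le hts htsb (by linarith) hθb
      have r3 := yi_rpow_le hts htsb (by linarith) hθc
      have hs := hmem s h1 (h2.trans h3)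
      have ht := hmem t (h1.trans h2) h3
      have g1 := hf2 s t h1 h2 h3
      have hXst := hX s t h1 h2 h3
      have hpτ : 0 ≤ (t - s) ^ τ := Real.rpow_nonneg hts _
      have hbd : ∀ z ∈ segment ℝ (x s) (x t),
          ‖fderiv ℝ (F t) z - fderiv ℝ (F t) (x s)‖ ≤ |Cx| * (X * (t - s) ^ τ) ^ lamF := by
        intro z hz
        have hzK : z ∈ Metric.closedBall (x a) R :=
          (convex_closedBall (x a) R).segment_subset hs ht hz
        have hzn : ‖z - x s‖ ≤ ‖x t - x s‖ := by
          obtain ⟨c, hc, rfl⟩ := (segment_eq_image' ℝ (x s) (x t)) ▸ hz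
          rw [add_sub_cancel_left, norm_smul, Real.norm_of_nonneg hc.1]
          exact mul_le_of_le_one_left (norm_nonneg _) hc.2
        refine (hCx t ⟨h1.trans h2, h3⟩ z (x s) hzK hs).trans ?_
        have := le_abs_self Cx
        have := hzn.trans hXst
        gcongr
      have g2 := Convex.norm_image_sub_le_of_norm_fderiv_le' (𝕜 := ℝ) (f := F t)
        (fun z _ => ((hFC1 t).differentiable (by norm_num)).differentiableAt) hbd
        (convex_segment (x s) (x t)) (left_mem_segment ℝ _ _) (right_mem_segment ℝ _ _)
      have g2' : ‖F t (x t) - F t (x s) - (fderiv ℝ (F t) (x s)) (x t - x s)‖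
          ≤ |Cx| * X ^ lamF * X * (t - s) ^ (τ + lamF * τ) := by
        refine g2.trans ?_
        calc _ ≤ |Cx| * (X * (t - s) ^ τ) ^ lamF * (X * (t - s) ^ τ) := by gcongr
          _ = _ := by
            rw [Real.mul_rpow hX0 hpτ, ← Real.rpow_mul hts, mul_comm τ lamF,
              Real.rpow_add' hts (by linarith)]
            ring
      have g3 : ‖(fderiv ℝ (F t) (x s) - fderiv ℝ (F s) (x s)) (x t - x s)‖
          ≤ |Ct| * X * (t - s) ^ (τ + τ) := by
        refine (ContinuousLinearMap.le_opNorm _ _).trans ?_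
        have e := hCt s t h1 h2 h3 (x s) hs
        have e' : Ct * (t - s) ^ τ ≤ |Ct| * (t - s) ^ τ :=
          mul_le_mul_of_nonneg_right (le_abs_self Ct) hpτ
        calc _ ≤ (|Ct| * (t - s) ^ τ) * (X * (t - s) ^ τ) :=
              mul_le_mul (e.trans e') hXst (norm_nonneg _) (by positivity)
          _ = _ := by rw [Real.rpow_add' hts (by linarith)]; ring
      have g4 : ‖(fderiv ℝ (F s) (x s)) (x t - x s - (W t (φ s) - W s (φ s)))‖
          ≤ M * K1 * (t - s) ^ (τ + lam * γ) := by
        refine (ContinuousLinearMap.le_opNorm _ _).trans ?_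
        rw [mul_assoc]
        exact mul_le_mul (hM s h1 (h2.trans h3)) (hxs s t h1 h2 h3) (norm_nonneg _) hM0
      have key : F t (x t) - f2 t - (F s (x s) - f2 s)
            - (fderiv ℝ (F s) (x s)) (W t (φ s) - W s (φ s))
          = -(f2 t - f2 s - (F t (x s) - F s (x s)))
            + (F t (x t) - F t (x s) - (fderiv ℝ (F t) (x s)) (x t - x s))
            + (fderiv ℝ (F t) (x s) - fderiv ℝ (F s) (x s)) (x t - x s)
            + (fderiv ℝ (F s) (x s)) (x t - x s - (W t (φ s) - W s (φ s))) := by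
        rw [sub_apply, map_sub (fderiv ℝ (F s) (x s)) (x t - x s)]
        abel
      rw [key]
      refine norm_add₄_le.trans ?_
      rw [norm_neg]
      have q1 := mul_le_mul_of_nonneg_left r2 hK2
      have q2 := mul_le_mul_of_nonneg_left r2
        (show 0 ≤ |Cx| * X ^ lamF * X by positivity)
      have q3 := mul_le_mul_of_nonneg_left r3 (show 0 ≤ |Ct| * X by positivity)
      have q4 := mul_le_mul_of_nonneg_left r1 (show 0 ≤ M * K1 by positivity)
      linarith)
  exact ⟨_, _, hI1, hI2, by abel⟩

end
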